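/- arXiv:2504.01497 — 2 statements merged into one kernel-verified Lean document; each statement's English description precedes it below -/
import Mathlib

section
/- Let (x_k), (v_k) be generated by the implicit Euler scheme. If the perturbation parameters satisfy 0 ≤ (√μ/2)Δ₂ ≤ Δ₁, then for any step size s > 0 and any initial points x₀, v₀, the Lyapunov function is nonincreasing: E(k+1) ≤ E(k) for all k ≥ 0. -/
open Filter Topology in
/-- First-order lower bound for a differentiable strongly convex function. -/
theorem StrongConvexOn.add_inner_gradient_add_le
    {H : Type*} [NormedAddCommGroup H] [InnerProductSpace ℝ H] [CompleteSpace H]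
    {f : H → ℝ} {μ : ℝ} (hsc : StrongConvexOn Set.univ μ f) {x : H}
    (hf : DifferentiableAt ℝ f x) (h : H) :
    f x + inner ℝ (gradient f x) h + μ / 2 * ‖h‖ ^ 2 ≤ f (x + h) := by
  have hline : HasDerivAt (fun t : ℝ => f (x + t • h)) (inner ℝ (gradient f x) h) 0 := by
    have hl : HasDerivAt (fun t : ℝ => x + t • h) h 0 := by
      simpa using ((hasDerivAt_id (0 : ℝ)).smul_const h).const_add x
    have hg : HasFDerivAt f (InnerProductSpace.toDual ℝ H (gradient f x)) (x + (0 : ℝ) • h) := by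
      simpa using hf.hasGradientAt.hasFDerivAt
    simpa only [Function.comp_def, InnerProductSpace.toDual_apply_apply] using
      hg.comp_hasDerivAt (0 : ℝ) hl
  have hslope := hline.tendsto_slope_zero_right
  have hbound : Tendsto (fun t : ℝ => f (x + h) - f x - (1 - t) * (μ / 2 * ‖h‖ ^ 2)) (𝓝[>] 0)
      (𝓝 (f (x + h) - f x - (1 - 0) * (μ / 2 * ‖h‖ ^ 2))) :=
    (Continuous.tendsto (by fun_prop) 0).mono_left nhdsWithin_le_nhds
  have hle : inner ℝ (gradient f x) h ≤ f (x + h) - f x - (1 - 0) * (μ / 2 * ‖h‖ ^ 2) := by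
    refine le_of_tendsto_of_tendsto hslope hbound ?_
    filter_upwards [Ioo_mem_nhdsGT (zero_lt_one' ℝ)] with t ht
    have hc := hsc.2 (Set.mem_univ x) (Set.mem_univ (x + h)) (sub_nonneg.2 ht.2.le) ht.1.le
      (by ring)
    have hp : (1 - t) • x + t • (x + h) = x + t • h := by module
    have hn : ‖x - (x + h)‖ = ‖h‖ := by simp
    rw [hp, hn] at hc
    simp only [smul_eq_mul, zero_add, zero_smul, add_zero] at hc ⊢
    rw [inv_mul_le_iff₀ ht.1]
    linarith
  linarith


/-- for the implicit Euler scheme, under `0 ≤ (√μ/2)Δ₂ ≤ Δ₁`, the Lyapunov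
function is nonincreasing. -/
theorem implicit_euler_lyapunov_nonincreasing
    {H : Type*} [NormedAddCommGroup H] [InnerProductSpace ℝ H] [CompleteSpace H]
    (f : H → ℝ) (μ : ℝ) (hμ : 0 < μ)
    (hf : ContDiff ℝ 1 f) (hsc : StrongConvexOn Set.univ μ f)
    (xs : H) (hmin : ∀ y, f xs ≤ f y)
    (s : ℝ) (hs : 0 < s)
    (Δ₁ Δ₂ : ℝ) (hΔ₁ : 0 ≤ Δ₁) (hΔ₂ : 0 ≤ Δ₂)
    (hcond : Real.sqrt μ / 2 * Δ₂ ≤ Δ₁)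
    (x v : ℕ → H)
    (hx : ∀ k, (Real.sqrt s)⁻¹ • (x (k + 1) - x k) = v (k + 1))
    (hv : ∀ k, (Real.sqrt s)⁻¹ • (v (k + 1) - v k) =
      -((2 * Real.sqrt μ) • v (k + 1)) - (1 + Δ₁) • gradient f (x (k + 1))
        - (Δ₂ / Real.sqrt s) • (gradient f (x (k + 1)) - gradient f (x k)))
    (E : ℕ → ℝ)
    (hE : ∀ k, E k = (1 + Real.sqrt (μ * s)) ^ k *
      ((1 + Δ₁) * (f (x k) - f xs) +
        (1 / 2) * ‖v k + Real.sqrt μ • (x k - xs) + Δ₂ • gradient f (x k)‖ ^ 2)) :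
    ∀ k, E (k + 1) ≤ E k := by
  intro k
  set a := Real.sqrt s
  set m := Real.sqrt μ
  have ha : 0 < a := Real.sqrt_pos.2 hs
  have hm : 0 < m := Real.sqrt_pos.2 hμ
  have hm2 : μ = m ^ 2 := (Real.sq_sqrt hμ.le).symm
  have hms : Real.sqrt (μ * s) = m * a := Real.sqrt_mul hμ.le s
  rw [hE, hE, hms, pow_succ, mul_assoc]
  refine mul_le_mul_of_nonneg_left ?_ (by positivity)
  have hdiff : DifferentiableAt ℝ f (x (k + 1)) := hf.differentiable (by norm_num) _
  have hprev := hsc.add_inner_gradient_add_le hdiff (-(a • v (k + 1)))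
  have hopt := hsc.add_inner_gradient_add_le hdiff (-(x (k + 1) - xs))
  have hxk : x (k + 1) + -(a • v (k + 1)) = x k := by
    rw [← hx k, smul_inv_smul₀ ha.ne']; abel
  have hxs : x (k + 1) + -(x (k + 1) - xs) = xs := by abel
  rw [hxk] at hprev
  rw [hxs] at hopt
  have hvk : v k = v (k + 1) + (2 * m * a) • v (k + 1)
      + (a * (1 + Δ₁)) • gradient f (x (k + 1))
      + Δ₂ • (gradient f (x (k + 1)) - gradient f (x k)) := by
    have h := congrArg (a • ·) (hv k)
    simp only [smul_inv_smul₀ ha.ne', smul_sub, smul_neg, smul_smul, mul_div_cancel₀ _ ha.ne'] at h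
    rw [← sub_eq_zero] at h ⊢
    rw [← neg_eq_zero, ← h]
    module
  have hw : v k + m • (x k - xs) + Δ₂ • gradient f (x k) =
      (v (k + 1) + m • (x (k + 1) - xs) + Δ₂ • gradient f (x (k + 1)))
        + a • (m • v (k + 1) + (1 + Δ₁) • gradient f (x (k + 1))) := by
    rw [hvk, ← hxk]
    module
  rw [hw]
  generalize f (x k) = F₀ at *
  generalize gradient f (x (k + 1)) = g at *
  generalize x (k + 1) - xs = D at *
  generalize v (k + 1) = u at *
  generalize f (x (k + 1)) = F₁ at *
  generalize f xs = F at *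
  have hsq : 0 ≤ ‖(m ^ 2 / 2) • D - g‖ ^ 2 := sq_nonneg _
  have hd : 0 ≤ ‖m • u + (1 + Δ₁) • g‖ ^ 2 := sq_nonneg _
  simp only [← real_inner_self_eq_norm_sq, inner_add_left, inner_add_right, inner_sub_left,
    inner_sub_right, inner_neg_left, inner_neg_right, real_inner_smul_left,
    real_inner_smul_right, real_inner_comm u g, real_inner_comm D g,
    real_inner_comm u D] at hprev hopt hsq hd ⊢
  have huu : 0 ≤ inner ℝ u u := real_inner_self_nonneg
  have hDD : 0 ≤ inner ℝ D D := real_inner_self_nonneg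
  have hgg : 0 ≤ inner ℝ g g := real_inner_self_nonneg
  rw [hm2] at hprev hopt
  have hδ : 0 ≤ Δ₁ - m / 2 * Δ₂ := sub_nonneg.2 hcond
  have hc : 0 ≤ 1 + Δ₁ := by linarith
  linarith [mul_le_mul_of_nonneg_left hprev hc,
    mul_le_mul_of_nonneg_left hopt (by positivity : 0 ≤ m * a * (1 + Δ₁)),
    mul_nonneg (by positivity : 0 ≤ a * Δ₂) hsq,
    mul_nonneg (by positivity : 0 ≤ a ^ 2 / 2) hd,
    mul_nonneg (by positivity : 0 ≤ a * m / 2) huu,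
    mul_nonneg (by positivity : 0 ≤ a ^ 2 * m ^ 2 / 2 * (1 + Δ₁)) huu,
    mul_nonneg (mul_nonneg (by positivity : 0 ≤ a * m ^ 3 / 2) hδ) hDD,
    mul_nonneg (mul_nonneg (by positivity : 0 ≤ a * Δ₂) hδ) hgg]
end

section
/- Let (x_k), (v_k) be generated by the symplectic Euler scheme. If the parameters satisfy (1) Δ₂√s < 1/L and (2) (√s/2)(1+Δ₁) ≤ Δ₂ ≤ √s(1+Δ₁), then for any initial points x₀, v₀, it holds for all k ≥ 0 that f(x_k) − f(x*) ≤ (1/((1 − LΔ₂√s)(1+Δ₁)))·(1 + √(μs)/(1+√(μs)))^{−k}·E(0). -/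
open scoped RealInnerProductSpace in
/-- First-order characterisation of strong convexity for a differentiable function. -/
theorem StrongConvexOn.add_inner_gradient_le
    {H : Type*} [NormedAddCommGroup H] [InnerProductSpace ℝ H] [CompleteSpace H]
    {f : H → ℝ} {μ : ℝ} (hsc : StrongConvexOn Set.univ μ f) (hf : Differentiable ℝ f) (x y : H) :
    f x + ⟪gradient f x, y - x⟫ + μ / 2 * ‖y - x‖ ^ 2 ≤ f y := by
  have hder : HasDerivAt (fun t : ℝ => f (x + t • (y - x))) ⟪gradient f x, y - x⟫ 0 := by
    have hgrad : HasFDerivAt f (InnerProductSpace.toDual ℝ H (gradient f x))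
        (x + (0 : ℝ) • (y - x)) := by
      simpa using (hf x).hasGradientAt.hasFDerivAt
    simpa [Function.comp_def] using hgrad.comp_hasDerivAt (0 : ℝ)
      (((hasDerivAt_id (0 : ℝ)).smul_const (y - x)).const_add x)
  have hslope := hder.tendsto_slope_zero_right
  have hbound : Filter.Tendsto (fun t : ℝ => f y - f x - (1 - t) * (μ / 2 * ‖y - x‖ ^ 2))
      (nhdsWithin 0 (Set.Ioi 0)) (nhds (f y - f x - (1 - 0) * (μ / 2 * ‖y - x‖ ^ 2))) :=
    (Continuous.tendsto (by fun_prop) 0).mono_left nhdsWithin_le_nhds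
  have hle := le_of_tendsto_of_tendsto hslope hbound (by
    filter_upwards [Ioo_mem_nhdsGT (zero_lt_one' ℝ)] with t ht
    have hconv := hsc.2 (Set.mem_univ y) (Set.mem_univ x) ht.1.le (sub_nonneg.2 ht.2.le)
      (add_sub_cancel t 1)
    have hpt : t • y + (1 - t) • x = x + t • (y - x) := by module
    rw [hpt] at hconv
    simp only [smul_eq_mul, zero_add, zero_smul, add_zero] at hconv ⊢
    rw [inv_mul_le_iff₀ ht.1]
    linarith)
  linarith

open scoped RealInnerProductSpace in
/-- The descent lemma for functions with Lipschitz gradient. -/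
theorem le_add_inner_gradient_of_lipschitz
    {H : Type*} [NormedAddCommGroup H] [InnerProductSpace ℝ H] [CompleteSpace H]
    {f : H → ℝ} {L : ℝ} (hf : Differentiable ℝ f)
    (hL : ∀ x y, ‖gradient f x - gradient f y‖ ≤ L * ‖x - y‖) (x y : H) :
    f y ≤ f x + ⟪gradient f x, y - x⟫ + L / 2 * ‖y - x‖ ^ 2 := by
  have hder : ∀ t : ℝ, HasDerivAt (fun t : ℝ => f (x + t • (y - x)))
      ⟪gradient f (x + t • (y - x)), y - x⟫ t := fun t => by
    simpa [Function.comp_def] using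
      (hf (x + t • (y - x))).hasGradientAt.hasFDerivAt.comp_hasDerivAt t
        (((hasDerivAt_id t).smul_const (y - x)).const_add x)
  have hquad : ∀ t : ℝ, HasDerivAt
      (fun t : ℝ => f x + t * ⟪gradient f x, y - x⟫ + L / 2 * ‖y - x‖ ^ 2 * t ^ 2)
      (⟪gradient f x, y - x⟫ + L * ‖y - x‖ ^ 2 * t) t := fun t => by
    refine ((((hasDerivAt_id t).mul_const ⟪gradient f x, y - x⟫).const_add (f x)).add
      ((hasDerivAt_pow 2 t).const_mul (L / 2 * ‖y - x‖ ^ 2))).congr_deriv ?_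
    norm_num
    ring
  have hle := image_le_of_deriv_right_le_deriv_boundary (a := 0) (b := 1)
    (fun t _ => (hder t).continuousAt.continuousWithinAt)
    (fun t _ => (hder t).hasDerivWithinAt) (by simp)
    (fun t _ => (hquad t).continuousAt.continuousWithinAt)
    (fun t _ => (hquad t).hasDerivWithinAt) (fun t ht => by
      have hcs := real_inner_le_norm (gradient f (x + t • (y - x)) - gradient f x) (y - x)
      have hlip := mul_le_mul_of_nonneg_right (hL (x + t • (y - x)) x) (norm_nonneg (y - x))
      rw [add_sub_cancel_left, norm_smul, Real.norm_of_nonneg ht.1] at hlip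
      rw [inner_sub_left] at hcs
      linarith)
    (Set.right_mem_Icc.2 zero_le_one)
  simp only [one_smul, add_sub_cancel, one_mul, one_pow, mul_one] at hle
  exact hle

open scoped RealInnerProductSpace in
/-- The first-order inequality for a convex function with `L`-Lipschitz gradient, improved by the
squared distance of the gradients. -/
theorem add_inner_gradient_add_sq_le_of_lipschitz
    {H : Type*} [NormedAddCommGroup H] [InnerProductSpace ℝ H] [CompleteSpace H]
    {f : H → ℝ} {L : ℝ} (hf : Differentiable ℝ f) (hconv : ConvexOn ℝ Set.univ f) (hL0 : 0 < L)
    (hL : ∀ x y, ‖gradient f x - gradient f y‖ ≤ L * ‖x - y‖) (x y : H) :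
    f x + ⟪gradient f x, y - x⟫ + 1 / (2 * L) * ‖gradient f y - gradient f x‖ ^ 2 ≤ f y := by
  set d := gradient f y - gradient f x with hd
  have hlow := (strongConvexOn_zero.2 hconv).add_inner_gradient_le hf x (y - L⁻¹ • d)
  have hup := le_add_inner_gradient_of_lipschitz hf hL y (y - L⁻¹ • d)
  have hstep : y - L⁻¹ • d - y = -(L⁻¹ • d) := by abel
  have hsplit : y - L⁻¹ • d - x = (y - x) - L⁻¹ • d := by abel
  have hdd : ⟪gradient f y, d⟫ - ⟪gradient f x, d⟫ = ‖d‖ ^ 2 := by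
    rw [← inner_sub_left, ← hd, real_inner_self_eq_norm_sq]
  rw [hstep, norm_neg, norm_smul, inner_neg_right, inner_smul_right,
    Real.norm_of_nonneg (inv_nonneg.2 hL0.le)] at hup
  rw [hsplit, inner_sub_right, inner_smul_right] at hlow
  have hdd' : ⟪gradient f y, d⟫ = ‖d‖ ^ 2 + ⟪gradient f x, d⟫ := by linarith
  have hsq : L / 2 * (L⁻¹ * ‖d‖) ^ 2 = 1 / (2 * L) * ‖d‖ ^ 2 := by field_simp
  have hlin : L⁻¹ * ‖d‖ ^ 2 = 2 * (1 / (2 * L) * ‖d‖ ^ 2) := by field_simp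
  rw [hsq, hdd', mul_add, hlin] at hup
  linarith

open scoped RealInnerProductSpace in
/-- Contraction of the Lyapunov energy along one step of the symplectic Euler scheme, in terms of
the new displacement `z`, the new velocity `p`, and the new and old gradients `g'` and `g`. -/
theorem symplectic_euler_energy_contraction
    {H : Type*} [NormedAddCommGroup H] [InnerProductSpace ℝ H]
    {a D h m c F F' : ℝ} {z p g g' : H} (ha : 1 ≤ a) (hD : 0 ≤ D) (hh : 0 < h) (hm : 0 < m)
    (hc : D * h ≤ c) (hlow : h / 2 * a ≤ D) (hup : D ≤ h * a) (hF' : 0 ≤ F')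
    (hco : F' + ⟪g', -(h • ((1 + 2 * (m * h)) • p + (h * a) • g' + D • (g' - g)))⟫
      + c / 2 * ‖g - g'‖ ^ 2 ≤ F)
    (hsc : F' + m ^ 2 / 2 * ‖z‖ ^ 2 ≤ ⟪g', z⟫) :
    (1 + m * h / (1 + m * h)) * (a * (F' - D * h / 2 * ‖g'‖ ^ 2) +
        1 / 2 * ‖p + m • (z + h • p) + D • g'‖ ^ 2) ≤
      a * (F - D * h / 2 * ‖g‖ ^ 2) +
        1 / 2 * ‖(1 + 2 * (m * h)) • p + (h * a) • g' + D • (g' - g) + m • z + D • g‖ ^ 2 := by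
  have hzg : 0 ≤ ⟪g', z⟫ := (by positivity : 0 ≤ F' + m ^ 2 / 2 * ‖z‖ ^ 2).trans hsc
  set q := m * h with hq
  have hq0 : 0 < q := by positivity
  set ρ := q / (1 + q) with hρ
  have hρ0 : 0 ≤ ρ := by positivity
  have hρq : ρ * (1 + q) = q := by rw [hρ]; field_simp
  have n1 := mul_nonneg (zero_le_one.trans ha) (sub_nonneg.2 hco)
  have n2 := mul_nonneg (mul_nonneg (zero_le_one.trans ha) (sub_nonneg.2 hc)) (sq_nonneg ‖g - g'‖)
  have n3 := mul_nonneg (mul_nonneg hρ0 (zero_le_one.trans ha)) (sub_nonneg.2 hsc)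
  have n4 := mul_nonneg (mul_nonneg hρ0 (sub_nonneg.2 ha)) (mul_nonneg (sq_nonneg m) (sq_nonneg ‖z‖))
  have n5 := mul_nonneg (mul_nonneg hρ0 hm.le) (mul_nonneg (sub_nonneg.2 hup) hzg)
  have n6 := mul_nonneg (mul_nonneg hh.le (zero_le_one.trans ha))
    (mul_nonneg (sub_nonneg.2 hlow) (sq_nonneg ‖g'‖))
  have n7 := mul_nonneg (mul_nonneg hρ0 hD) (mul_nonneg (sub_nonneg.2 hup) (sq_nonneg ‖g'‖))
  have n8 : 0 ≤ (q / 2 + q ^ 2) * ‖p‖ ^ 2 := by positivity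
  have hw' : p + m • (z + h • p) + D • g' = (1 + q) • p + m • z + D • g' := by
    rw [hq]; module
  have hw : (1 + 2 * q) • p + (h * a) • g' + D • (g' - g) + m • z + D • g =
      (1 + 2 * q) • p + (h * a + D) • g' + m • z := by module
  rw [hw, hw']
  simp only [← real_inner_self_eq_norm_sq, inner_add_left, inner_add_right, inner_sub_left,
    inner_sub_right, inner_neg_right, inner_smul_left, inner_smul_right, RCLike.conj_to_real,
    real_inner_comm p g', real_inner_comm z g', real_inner_comm z p, real_inner_comm g g'] at *
  clear_value ρ q
  subst hq
  linear_combination n1 + n2 / 2 + n3 + n4 / 2 + n5 + n6 + n7 / 2 + n8 +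
    ((1 + m * h) / 2 * ⟪p, p⟫ + m * ⟪z, p⟫ + D * ⟪p, g'⟫ + a * ⟪z, g'⟫) * hρq


/-- for the symplectic Euler scheme under the simplified sufficient conditions,
the function values converge at the stated rate. -/
theorem symplectic_euler_corollary_rate
    {H : Type*} [NormedAddCommGroup H] [InnerProductSpace ℝ H] [CompleteSpace H]
    (f : H → ℝ) (μ L : ℝ) (hμ : 0 < μ)
    (hf : ContDiff ℝ 1 f) (hsc : StrongConvexOn Set.univ μ f)
    (hL : ∀ x y, ‖gradient f x - gradient f y‖ ≤ L * ‖x - y‖)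
    (xs : H) (hmin : ∀ y, f xs ≤ f y)
    (s : ℝ) (hs : 0 < s)
    (Δ₁ Δ₂ : ℝ) (hΔ₁ : 0 ≤ Δ₁) (hΔ₂ : 0 ≤ Δ₂)
    (x v : ℕ → H)
    (hx : ∀ k, (Real.sqrt s)⁻¹ • (x (k + 1) - x k) = v k)
    (hv : ∀ k, (Real.sqrt s)⁻¹ • (v (k + 1) - v k) =
      -((2 * Real.sqrt μ) • v (k + 1)) - (1 + Δ₁) • gradient f (x (k + 1))
        - (Δ₂ / Real.sqrt s) • (gradient f (x (k + 1)) - gradient f (x k)))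
    (E : ℕ → ℝ)
    (hE : ∀ k, E k = (1 + Real.sqrt (μ * s) / (1 + Real.sqrt (μ * s))) ^ k *
      ((1 + Δ₁) * (f (x k) - f xs - Δ₂ * Real.sqrt s / 2 * ‖gradient f (x k)‖ ^ 2) +
        (1 / 2) * ‖v k + Real.sqrt μ • (x (k + 1) - xs) + Δ₂ • gradient f (x k)‖ ^ 2))
    (h1 : Δ₂ * Real.sqrt s < 1 / L)
    (h2 : Real.sqrt s / 2 * (1 + Δ₁) ≤ Δ₂) (h2' : Δ₂ ≤ Real.sqrt s * (1 + Δ₁)) :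
    ∀ k, f (x k) - f xs ≤
      1 / ((1 - L * Δ₂ * Real.sqrt s) * (1 + Δ₁)) *
        ((1 + Real.sqrt (μ * s) / (1 + Real.sqrt (μ * s))) ^ k)⁻¹ * E 0 := by
  have hdiff : Differentiable ℝ f := hf.differentiable (by norm_num)
  have hconv : ConvexOn ℝ Set.univ f := strongConvexOn_zero.1 (hsc.mono hμ.le)
  have hL0 : 0 < L := one_div_pos.1 ((by positivity : 0 ≤ Δ₂ * Real.sqrt s).trans_lt h1)
  have hgxs : gradient f xs = 0 := by
    have hmin' : IsLocalMin f xs := Filter.Eventually.of_forall hmin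
    rw [gradient, hmin'.fderiv_eq_zero, map_zero]
  rw [Real.sqrt_mul hμ.le] at *
  have hm2 : Real.sqrt μ ^ 2 = μ := Real.sq_sqrt hμ.le
  have hm : 0 < Real.sqrt μ := Real.sqrt_pos.2 hμ
  have hh : 0 < Real.sqrt s := Real.sqrt_pos.2 hs
  set m := Real.sqrt μ
  set h := Real.sqrt s
  have hxk : ∀ k, x k - x (k + 1) = -(h • v k) := fun k => by
    rw [← hx k, smul_inv_smul₀ hh.ne', neg_sub]
  have hvk : ∀ k, v k = (1 + 2 * (m * h)) • v (k + 1) + (h * (1 + Δ₁)) • gradient f (x (k + 1)) +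
      Δ₂ • (gradient f (x (k + 1)) - gradient f (x k)) := fun k => by
    have hstep := congrArg (h • ·) (hv k)
    simp only [smul_inv_smul₀ hh.ne'] at hstep
    calc v k = v (k + 1) - (v (k + 1) - v k) := (sub_sub_cancel _ _).symm
      _ = (1 + 2 * (m * h)) • v (k + 1) + (h * (1 + Δ₁)) • gradient f (x (k + 1)) +
          (h * (Δ₂ / h)) • (gradient f (x (k + 1)) - gradient f (x k)) := by
        rw [hstep]; module
      _ = _ := by rw [mul_div_cancel₀ Δ₂ hh.ne']
  have hT : 0 < 1 + m * h / (1 + m * h) := by positivity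
  have hanti : Antitone E := antitone_nat_of_succ_le fun k => by
    rw [hE k, hE (k + 1), pow_succ, mul_assoc]
    refine mul_le_mul_of_nonneg_left ?_ (by positivity)
    have hx2 : x (k + 1 + 1) - xs = (x (k + 1) - xs) + h • v (k + 1) := by
      have := hxk (k + 1)
      rw [← neg_eq_iff_eq_neg, neg_sub] at this
      rw [← this]; abel
    have hco := add_inner_gradient_add_sq_le_of_lipschitz hdiff hconv hL0 hL (x (k + 1)) (x k)
    have hfo := hsc.add_inner_gradient_le hdiff (x (k + 1)) xs
    rw [← neg_sub, inner_neg_right, norm_neg] at hfo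
    have hcc : 1 / (2 * L) = 1 / L / 2 := by field_simp
    have hres := symplectic_euler_energy_contraction (a := 1 + Δ₁) (D := Δ₂) (h := h) (m := m)
      (c := 1 / L) (F := f (x k) - f xs) (F' := f (x (k + 1)) - f xs) (z := x (k + 1) - xs)
      (p := v (k + 1)) (g := gradient f (x k)) (g' := gradient f (x (k + 1)))
      (by linarith) hΔ₂ hh hm h1.le h2 h2' (sub_nonneg.2 (hmin _))
      (by rw [← hvk k, ← hxk k, ← hcc]; linarith) (by rw [hm2]; linarith)
    rwa [← hvk k, ← hx2] at hres
  intro k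
  have hEk := hanti (Nat.zero_le k)
  have hgrad := add_inner_gradient_add_sq_le_of_lipschitz hdiff hconv hL0 hL xs (x k)
  rw [hgxs, inner_zero_left, sub_zero, add_zero, one_div_mul_eq_div] at hgrad
  have hgrad' : ‖gradient f (x k)‖ ^ 2 ≤ 2 * L * (f (x k) - f xs) := by
    rw [← div_le_iff₀' (by positivity)]; linarith
  have hgap : 0 < 1 - L * Δ₂ * h := by
    rw [lt_div_iff₀ hL0] at h1; linarith
  have hTk := pow_pos hT k
  have hmul := mul_le_mul_of_nonneg_left hgrad' (by positivity : 0 ≤ Δ₂ * h / 2)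
  have hlow : (1 + m * h / (1 + m * h)) ^ k *
      ((1 + Δ₁) * ((1 - L * Δ₂ * h) * (f (x k) - f xs))) ≤ E k := by
    rw [hE k]
    refine mul_le_mul_of_nonneg_left ?_ hTk.le
    refine le_add_of_le_of_nonneg (mul_le_mul_of_nonneg_left ?_ (by linarith)) (by positivity)
    linarith
  have hden : 0 < (1 - L * Δ₂ * h) * (1 + Δ₁) := by positivity
  rw [one_div, ← mul_inv, inv_mul_eq_div, le_div_iff₀ (by positivity)]
  linarith
end
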